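/- Let $A_\Gamma$ be an Artin group with standard generating set $X$ and Artin monoid $M$. If there exist pairwise distinct $a, b, c \in X$ such that $m(a,b)$, $m(b,c)$, and $m(a,c)$ are all finite and all at least $3$ (i.e., $\Gamma$ contains a triangle with all labels $\geq 3$), then the monoid Cayley graph $\mathrm{Cay}(A_\Gamma, M)$ has infinite diameter; that is, for every $n$ there is $g \in A_\Gamma$ with $d_M(e,g) > n$. -/

import Mathlib

/-- The alternating product `x y x y ⋯` of length `n` in the free group, starting with `x`. -/
def altProd {X : Type*} : ℕ → X → X → FreeGroup X
  | 0, _, _ => 1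
  | n + 1, x, y => FreeGroup.of x * altProd n y x

/-- The Artin relations associated to a labelling `m : X → X → ℕ∞` (label `⊤` = no relation):
for each pair `x ≠ y` with finite label `k`, the relator `(xyx⋯)(yxy⋯)⁻¹` (both of length `k`). -/
def artinRels {X : Type*} (m : X → X → ℕ∞) : Set (FreeGroup X) :=
  { r | ∃ (x y : X) (k : ℕ), x ≠ y ∧ m x y = (k : ℕ∞) ∧
      r = altProd k x y * (altProd k y x)⁻¹ }

/-- The Artin group of the labelled graph encoded by `m`. -/
abbrev ArtinGroup {X : Type*} (m : X → X → ℕ∞) : Type _ := PresentedGroup (artinRels m)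

/-- The standard generators of the Artin group. -/
def artinGen {X : Type*} (m : X → X → ℕ∞) (x : X) : ArtinGroup m := PresentedGroup.of x

/-- The Artin monoid: the submonoid of the Artin group generated by the standard generators. -/
def artinMonoid {X : Type*} (m : X → X → ℕ∞) : Submonoid (ArtinGroup m) :=
  Submonoid.closure (Set.range (artinGen m))

/-- The monoid word metric on a group `G` relative to a submonoid `M`: `monoidDist M g h` is the
least `n` such that `g⁻¹ * h` is a product of `n` elements each lying in `M` or `M⁻¹`. -/
noncomputable def monoidDist {G : Type*} [Group G] (M : Submonoid G) (g h : G) : ℕ :=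
  sInf { n : ℕ | ∃ l : List G, l.length = n ∧ (∀ a ∈ l, a ∈ M ∨ a⁻¹ ∈ M) ∧ g⁻¹ * h = l.prod }

/-- A word over `X`: a list of letters `x^ε`, where `ε = true` denotes the positive letter `x`
and `ε = false` the negative letter `x⁻¹`. -/
abbrev Word (X : Type*) := List (X × Bool)

/-- The element of `G` represented by a word over `X`, given `f : X → G`. -/
def evalWord {X G : Type*} [Group G] (f : X → G) (w : Word X) : G :=
  (w.map (fun p => if p.2 then f p.1 else (f p.1)⁻¹)).prod

/-- A word is positive if all its letters are positive. -/
def IsPosWord {X : Type*} (w : Word X) : Prop := ∀ p ∈ w, p.2 = true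

/-- A word is negative if all its letters are negative. -/
def IsNegWord {X : Type*} (w : Word X) : Prop := ∀ p ∈ w, p.2 = false

/-- A word is geodesic if no strictly shorter word represents the same element of `G`. -/
def IsGeodesic {X G : Type*} [Group G] (f : X → G) (w : Word X) : Prop :=
  ∀ v : Word X, evalWord f v = evalWord f w → w.length ≤ v.length

/-- `(u, x)` is a blocking pair if for every word `w` such that `w ++ u` is geodesic,
the word `w ++ u ++ [x]` is also geodesic. -/
def BlockingPair {X G : Type*} [Group G] (f : X → G) (u : Word X) (x : X × Bool) : Prop :=
  ∀ w : Word X, IsGeodesic f (w ++ u) → IsGeodesic f (w ++ u ++ [x])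

/-- An alternating blocking sequence `(α n)` (indexed from `n = 1`; the value `α 0` is ignored):
each `α n` is nonempty, positive for odd `n` and negative for even `n`, and every letter `x`
of `α n` is immediately preceded, within `α (n-1) ++ α n` (with `α 0` read as the empty word),
by a subword `u` such that `(u, x)` is a blocking pair. -/
def IsAltBlockingSeq {X G : Type*} [Group G] (f : X → G) (α : ℕ → Word X) : Prop :=
  (∀ n, 1 ≤ n → α n ≠ []) ∧
  (∀ n, 1 ≤ n → Odd n → IsPosWord (α n)) ∧
  (∀ n, 1 ≤ n → Even n → IsNegWord (α n)) ∧
  (∀ n, 1 ≤ n → ∀ p x s, α n = p ++ x :: s →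
    ∃ u : Word X, u <:+ ((if n = 1 then ([] : Word X) else α (n - 1)) ++ p) ∧
      BlockingPair f u x)

/-- `u` is the longest positive (`ε = true`) resp. negative (`ε = false`) proper suffix of `w`. -/
def IsLongestSignedProperSuffix {X : Type*} (ε : Bool) (w u : Word X) : Prop :=
  u <:+ w ∧ u ≠ w ∧ (∀ p ∈ u, p.2 = ε) ∧
    ∀ v : Word X, v <:+ w → v ≠ w → (∀ p ∈ v, p.2 = ε) → v.length ≤ u.length

/-- Preserved positive (`ε = true`) resp. negative (`ε = false`) suffixes: whenever `w` is a
geodesic word ending in a letter of sign `ε`, `u` is the longest proper suffix of `w` of sign `ε`,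
and `a` is a generator, the element represented by `a^ε · w` admits a geodesic representative
having `u` as a suffix. -/
def PreservedSignSuffixes {X G : Type*} [Group G] (ε : Bool) (f : X → G) : Prop :=
  ∀ (w : Word X) (y : X), IsGeodesic f w → w.getLast? = some (y, ε) →
    ∀ u : Word X, IsLongestSignedProperSuffix ε w u →
    ∀ a : X, ∃ w' : Word X, IsGeodesic f w' ∧
      evalWord f w' = evalWord f ((a, ε) :: w) ∧ u <:+ w'

/-- Preserved signed suffixes: both preserved positive and preserved negative suffixes. -/
def PreservedSignedSuffixes {X G : Type*} [Group G] (f : X → G) : Prop :=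
  PreservedSignSuffixes true f ∧ PreservedSignSuffixes false f

/-! ### Sign changes in free groups -/

/-- The number of sign changes in the word `L`, read after an initial letter of sign `s`. -/
def signChanges {ι : Type*} : Bool → List (ι × Bool) → ℕ
  | _, [] => 0
  | s, p :: L => (if s = p.2 then 0 else 1) + signChanges p.2 L

theorem signChanges_le_add_one {ι : Type*} (s t : Bool) (L : List (ι × Bool)) :
    signChanges s L ≤ signChanges t L + 1 := by
  cases L with
  | nil => simp [signChanges]
  | cons p L => simp only [signChanges]; split_ifs <;> omega

theorem signChanges_toWord_mk_mul_le {ι : Type*} [DecidableEq ι] (i : ι) (s : Bool)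
    (h : FreeGroup ι) :
    signChanges s (FreeGroup.mk [(i, s)] * h).toWord ≤ signChanges s h.toWord := by
  have key : (FreeGroup.mk [(i, s)] * h).toWord = FreeGroup.reduce ((i, s) :: h.toWord) := by
    conv_lhs => rw [← FreeGroup.mk_toWord (x := h)]
    rw [FreeGroup.mul_mk, FreeGroup.toWord_mk]
    rfl
  rw [key, FreeGroup.reduce.cons, FreeGroup.reduce_toWord]
  rcases h.toWord with - | ⟨p, L⟩
  · simp [signChanges]
  · have hs := signChanges_le_add_one s p.2 L
    by_cases hp : i = p.1 ∧ s = !p.2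
    · have : s ≠ p.2 := by rw [hp.2]; simp
      simp only [if_pos hp, signChanges, if_neg this]
      omega
    · simp [if_neg hp, signChanges]

theorem signChanges_of_mul_le {ι : Type*} [DecidableEq ι] (i : ι) (h : FreeGroup ι) :
    signChanges true (FreeGroup.of i * h).toWord ≤ signChanges true h.toWord :=
  signChanges_toWord_mk_mul_le i true h

theorem signChanges_of_inv_mul_le {ι : Type*} [DecidableEq ι] (i : ι) (h : FreeGroup ι) :
    signChanges false ((FreeGroup.of i)⁻¹ * h).toWord ≤ signChanges false h.toWord :=
  signChanges_toWord_mk_mul_le i false h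

theorem signChanges_toWord_pow (n : ℕ) :
    signChanges false (((FreeGroup.of true * (FreeGroup.of false)⁻¹) ^ n :
      FreeGroup Bool)).toWord = 2 * n := by
  have key : ((FreeGroup.of true * (FreeGroup.of false)⁻¹) ^ n : FreeGroup Bool).toWord
      = (List.replicate n [(true, true), (false, false)]).flatten := by
    induction n with
    | zero => simp
    | succ n ih =>
      have h : ((FreeGroup.of true * (FreeGroup.of false)⁻¹) ^ (n + 1) : FreeGroup Bool)
          = FreeGroup.mk ((true, true) :: (false, false) ::
            ((FreeGroup.of true * (FreeGroup.of false)⁻¹) ^ n : FreeGroup Bool).toWord) := by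
        rw [pow_succ']
        conv_lhs => rw [← FreeGroup.mk_toWord
          (x := ((FreeGroup.of true * (FreeGroup.of false)⁻¹) ^ n : FreeGroup Bool))]
        rfl
      rw [h, FreeGroup.toWord_mk, FreeGroup.reduce.cons, FreeGroup.reduce.cons,
        FreeGroup.reduce_toWord, ih]
      cases n <;> simp [List.replicate_succ]
  rw [key]
  clear key
  induction n with
  | zero => simp [signChanges]
  | succ n ih =>
    simp only [List.replicate_succ, List.flatten_cons, List.cons_append, List.nil_append,
      signChanges, Bool.false_eq_true, Bool.true_eq_false, if_false, ih]
    omega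

/-! ### Reflections and dihedral groups -/

section Reflections

open Real

variable {V : Type*} [AddCommGroup V] [Module ℝ V] (B : V →ₗ[ℝ] V →ₗ[ℝ] ℝ)

/-- The map `v ↦ v - 2 B(v, p) p`, the orthogonal reflection in `p` when `B(p, p) = 1`. -/
noncomputable def formReflection (p : V) : Module.End ℝ V :=
  LinearMap.id - (2 : ℝ) • (B.flip p).smulRight p

theorem formReflection_apply (p v : V) : formReflection B p v = v - (2 * B v p) • p := by
  simp [formReflection, smul_smul]

variable {B}

theorem formReflection_self {p : V} (hp : B p p = 1) : formReflection B p p = -p := by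
  rw [formReflection_apply, hp]; module

theorem formReflection_involutive {p : V} (hp : B p p = 1) (v : V) :
    formReflection B p (formReflection B p v) = v := by
  simp only [formReflection_apply, map_sub, map_smul, hp]
  module

theorem formReflection_eq_iff {p : V} (hp : B p p = 1) {v w : V} :
    formReflection B p v = w ↔ v = formReflection B p w :=
  ⟨fun h => by rw [← h, formReflection_involutive hp],
    fun h => by rw [h, formReflection_involutive hp]⟩

theorem apply_formReflection (hB : ∀ v w, B v w = B w v) {p : V} (hp : B p p = 1) (v w : V) :
    B (formReflection B p v) (formReflection B p w) = B v w := by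
  simp only [formReflection_apply, map_sub, map_smul, LinearMap.sub_apply, LinearMap.smul_apply,
    hp, smul_eq_mul, hB p w]
  ring

variable (B) in
/-- The alternating product of `n` reflections in `p, q, p, …`, the last one being applied
first. -/
noncomputable def altReflection : ℕ → V → V → Module.End ℝ V
  | 0, _, _ => 1
  | n + 1, p, q => formReflection B p * altReflection n q p

theorem apply_altReflection (hB : ∀ v w, B v w = B w v) (n : ℕ) {p q : V} (hp : B p p = 1)
    (hq : B q q = 1) (v w : V) :
    B (altReflection B n p q v) (altReflection B n p q w) = B v w := by
  induction n generalizing p q with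
  | zero => rfl
  | succ n ih =>
    rw [altReflection, Module.End.mul_apply, Module.End.mul_apply, apply_formReflection hB hp,
      ih hq hp]

theorem altReflection_apply_of_orthogonal (n : ℕ) {p q v : V} (hp : B v p = 0)
    (hq : B v q = 0) : altReflection B n p q v = v := by
  induction n generalizing p q with
  | zero => rfl
  | succ n ih =>
    rw [altReflection, Module.End.mul_apply, ih hq hp, formReflection_apply, hp]; simp

/-- For unit vectors `p, q` at angle `π - θ`, the vector of length `sin θ` at angle `φ` from `p`
in their plane. -/
noncomputable def planeVec (θ φ : ℝ) (p q : V) : V := sin (φ + θ) • p + sin φ • q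

theorem planeVec_swap (θ φ : ℝ) (p q : V) :
    planeVec θ φ p q = planeVec θ (π - θ - φ) q p := by
  unfold planeVec
  rw [show π - θ - φ + θ = π - φ by ring, show π - θ - φ = π - (φ + θ) by ring, sin_pi_sub,
    sin_pi_sub, add_comm]

theorem planeVec_add_pi (θ φ : ℝ) (p q : V) :
    planeVec θ (φ + π) p q = -planeVec θ φ p q := by
  unfold planeVec
  rw [show φ + π + θ = φ + θ + π by ring, sin_add_pi, sin_add_pi]
  module

theorem formReflection_planeVec (θ φ : ℝ) {p q : V} (hp : B p p = 1) (hqp : B q p = -cos θ) :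
    formReflection B p (planeVec θ φ q p) = planeVec θ (φ + θ) p q := by
  unfold planeVec
  have h : sin (φ + θ + θ) = 2 * cos θ * sin (φ + θ) - sin φ := by
    have h' : sin φ = sin (φ + θ - θ) := by rw [add_sub_cancel_right]
    rw [h', sin_sub, sin_add (φ + θ)]; ring
  simp only [formReflection_apply, map_add, map_smul, hp, hqp, h]
  module

theorem altReflection_planeVec (n : ℕ) (θ φ : ℝ) {p q : V} (hp : B p p = 1) (hq : B q q = 1)
    (hpq : B p q = -cos θ) (hqp : B q p = -cos θ) :
    altReflection B n p q (if Even n then planeVec θ φ p q else planeVec θ φ q p)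
      = planeVec θ (φ + n * θ) p q := by
  induction n generalizing p q with
  | zero => simp [altReflection]
  | succ n ih =>
    have := ih hq hp hqp hpq
    rw [altReflection, Module.End.mul_apply]
    have e : (if Even (n + 1) then planeVec θ φ p q else planeVec θ φ q p)
        = if Even n then planeVec θ φ q p else planeVec θ φ p q := by
      by_cases h : Even n <;> simp [h, Nat.even_add_one]
    rw [e, this, formReflection_planeVec _ _ hp hqp]
    push_cast
    congr 1
    ring

theorem apply_planeVec (θ φ ψ : ℝ) {p q : V} (hp : B p p = 1) (hq : B q q = 1)
    (hpq : B p q = -cos θ) (hqp : B q p = -cos θ) :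
    B (planeVec θ φ p q) (planeVec θ ψ p q) = sin θ ^ 2 * cos (φ - ψ) := by
  simp only [planeVec, map_add, map_smul, LinearMap.add_apply, LinearMap.smul_apply, hp, hq, hpq,
    hqp, smul_eq_mul, sin_add, cos_sub]
  have h := sin_sq_add_cos_sq θ
  linear_combination (- sin φ * sin ψ) * h

theorem sin_pi_div_pos {k : ℕ} (hk : 2 ≤ k) : 0 < sin (π / k) := by
  have h2 : (2 : ℝ) ≤ k := by exact_mod_cast hk
  refine sin_pos_of_pos_of_lt_pi (by positivity) ?_
  rw [div_lt_iff₀ (by positivity)]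
  nlinarith [pi_pos]

/-- The braid relation for the reflections in two unit vectors at angle `π - π / k`. -/
theorem altReflection_comm {k : ℕ} (hk : 2 ≤ k) {p q : V} (hp : B p p = 1) (hq : B q q = 1)
    (hpq : B p q = -cos (π / k)) (hqp : B q p = -cos (π / k)) :
    altReflection B k p q = altReflection B k q p := by
  have hs := (sin_pi_div_pos hk).ne'
  have hkθ : (k : ℝ) * (π / k) = π := by
    have : (k : ℝ) ≠ 0 := by positivity
    field_simp
  set θ := π / k with hθ
  have hplane (φ : ℝ) : altReflection B k p q (planeVec θ φ p q)
      = altReflection B k q p (planeVec θ φ p q) := by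
    have h₁ (ψ : ℝ) := altReflection_planeVec k θ ψ hp hq hpq hqp
    have h₂ (ψ : ℝ) := altReflection_planeVec k θ ψ hq hp hqp hpq
    by_cases h : Even k
    · simp only [h, if_true, hkθ, planeVec_add_pi] at h₁ h₂
      rw [h₁, planeVec_swap, h₂]
    · simp only [h, if_false, hkθ, planeVec_add_pi] at h₁ h₂
      rw [h₂, planeVec_swap, h₁, planeVec_swap]
      congr 2
      ring
  have hP : p = (sin θ)⁻¹ • planeVec θ 0 p q := by
    simp [planeVec, smul_smul, hs]
  have hQ : q = (-(sin θ)⁻¹) • planeVec θ (-θ) p q := by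
    simp [planeVec, smul_smul, hs]
  have hpp : altReflection B k p q p = altReflection B k q p p := by
    conv_lhs => rw [← LinearMap.congr_arg hP.symm]
    conv_rhs => rw [← LinearMap.congr_arg hP.symm]
    rw [map_smul, map_smul, hplane]
  have hqq : altReflection B k p q q = altReflection B k q p q := by
    conv_lhs => rw [← LinearMap.congr_arg hQ.symm]
    conv_rhs => rw [← LinearMap.congr_arg hQ.symm]
    rw [map_smul, map_smul, hplane]
  ext v
  obtain ⟨x, y, v₀, hv, h₀p, h₀q⟩ :
      ∃ (x y : ℝ) (v₀ : V), v = v₀ + x • p + y • q ∧ B v₀ p = 0 ∧ B v₀ q = 0 := by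
    have hs2 : 1 - cos θ ^ 2 ≠ 0 := by rw [← sin_sq]; exact pow_ne_zero 2 hs
    refine ⟨(B v p + cos θ * B v q) / (1 - cos θ ^ 2), (B v q + cos θ * B v p) / (1 - cos θ ^ 2),
      v - ((B v p + cos θ * B v q) / (1 - cos θ ^ 2)) • p
        - ((B v q + cos θ * B v p) / (1 - cos θ ^ 2)) • q, by module, ?_, ?_⟩
    · simp only [map_sub, map_smul, LinearMap.sub_apply, LinearMap.smul_apply, hp, hqp,
        smul_eq_mul]
      field_simp
      ring
    · simp only [map_sub, map_smul, LinearMap.sub_apply, LinearMap.smul_apply, hq, hpq,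
        smul_eq_mul]
      field_simp
      ring
  rw [hv, map_add, map_add, map_add, map_add, map_smul, map_smul, map_smul, map_smul, hpp, hqq,
    altReflection_apply_of_orthogonal k h₀p h₀q, altReflection_apply_of_orthogonal k h₀q h₀p]

/-- The positive roots of the dihedral root system with simple roots `p, q` at angle `π - θ`. -/
noncomputable def dihedralRoot (θ : ℝ) (j : ℕ) (p q : V) : V :=
  (sin θ)⁻¹ • planeVec θ (j * θ) p q

theorem dihedralRoot_zero {θ : ℝ} (hθ : sin θ ≠ 0) (p q : V) : dihedralRoot θ 0 p q = p := by
  simp [dihedralRoot, planeVec, smul_smul, hθ]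

theorem dihedralRoot_succ (θ : ℝ) (j : ℕ) {p q : V} (hp : B p p = 1) (hqp : B q p = -cos θ) :
    dihedralRoot θ (j + 1) p q = formReflection B p (dihedralRoot θ j q p) := by
  rw [dihedralRoot, dihedralRoot, map_smul, formReflection_planeVec _ _ hp hqp]
  push_cast
  congr 2
  ring

theorem dihedralRoot_reverse {k : ℕ} {j : ℕ} (hj : j < k) (p q : V) :
    dihedralRoot (π / k) (k - 1 - j) p q = dihedralRoot (π / k) j q p := by
  rw [dihedralRoot, dihedralRoot, planeVec_swap]
  congr 2
  have hk : (k : ℝ) ≠ 0 := by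
    have : 0 < k := by omega
    positivity
  rw [Nat.cast_sub (by omega), Nat.cast_sub (by omega)]
  field_simp
  push_cast
  ring

theorem neg_one_lt_apply_dihedralRoot {k i j : ℕ} (hk : 2 ≤ k) (hi : i < k) (hj : j < k) {p q : V}
    (hp : B p p = 1) (hq : B q q = 1) (hpq : B p q = -cos (π / k)) (hqp : B q p = -cos (π / k)) :
    -1 < B (dihedralRoot (π / k) i p q) (dihedralRoot (π / k) j p q) := by
  have hs := (sin_pi_div_pos hk).ne'
  have hk0 : (0 : ℝ) < k := by positivity
  simp only [dihedralRoot, map_smul, LinearMap.smul_apply, apply_planeVec _ _ _ hp hq hpq hqp,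
    smul_eq_mul]
  have e : (sin (π / k))⁻¹ * ((sin (π / k))⁻¹ *
      (sin (π / k) ^ 2 * cos (i * (π / k) - j * (π / k)))) = cos |((i : ℝ) - j) * (π / k)| := by
    rw [cos_abs, ← sub_mul]
    field_simp
  rw [e, ← cos_pi]
  refine cos_lt_cos_of_nonneg_of_le_pi (abs_nonneg _) le_rfl ?_
  rw [abs_mul, abs_of_pos (by positivity : 0 < π / k), ← mul_div_assoc, div_lt_iff₀ hk0, mul_comm]
  refine mul_lt_mul_of_pos_left ?_ pi_pos
  have hi' : (i : ℝ) < k := by exact_mod_cast hi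
  have hj' : (j : ℝ) < k := by exact_mod_cast hj
  rw [abs_lt]
  constructor <;> linarith [(Nat.cast_nonneg i : (0 : ℝ) ≤ i), (Nat.cast_nonneg j : (0 : ℝ) ≤ j)]

end Reflections

/-! ### The action recording the crossings of two disjoint walls -/

section Crossing

open Real

variable {V : Type*} [AddCommGroup V] [Module ℝ V] (B : V →ₗ[ℝ] V →ₗ[ℝ] ℝ)

open Classical in
/-- The positive element of the free group on two letters recording that a reflection in `p`
crosses the wall of `v` or the wall of `w`, provided these walls are disjoint. -/
noncomputable def crossing (p v w : V) : FreeGroup Bool :=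
  if B v w ≤ -1 then
    (if v = p then FreeGroup.of true else 1) * (if w = p then FreeGroup.of false else 1)
  else 1

variable {B}

theorem crossing_eq_one {p v w : V} (hv : v ≠ p) (hw : w ≠ p) : crossing B p v w = 1 := by
  simp [crossing, hv, hw]

theorem crossing_left {p w : V} (hvw : B p w ≤ -1) (hw : w ≠ p) :
    crossing B p p w = FreeGroup.of true := by
  simp [crossing, hvw, hw]

theorem crossing_right {p v : V} (hvw : B v p ≤ -1) (hv : v ≠ p) :
    crossing B p v p = FreeGroup.of false := by
  simp [crossing, hvw, hv]

theorem signChanges_crossing_mul_le (p v w : V) (h : FreeGroup Bool) :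
    signChanges true (crossing B p v w * h).toWord ≤ signChanges true h.toWord := by
  unfold crossing
  split_ifs
  all_goals simp only [one_mul, mul_one, mul_assoc, le_refl]
  · exact (signChanges_of_mul_le _ _).trans (signChanges_of_mul_le _ _)
  all_goals exact signChanges_of_mul_le _ _

theorem signChanges_crossing_inv_mul_le (p v w : V) (h : FreeGroup Bool) :
    signChanges false ((crossing B p v w)⁻¹ * h).toWord ≤ signChanges false h.toWord := by
  unfold crossing
  split_ifs
  all_goals simp only [one_mul, mul_one, mul_assoc, le_refl, mul_inv_rev, inv_one]
  · exact (signChanges_of_inv_mul_le _ _).trans (signChanges_of_inv_mul_le _ _)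
  all_goals exact signChanges_of_inv_mul_le _ _

/-- The reflection in the unit vector `p` acting on pairs of vectors, together with a record in
the free group of the walls crossed. -/
noncomputable def crossingPerm {p : V} (hp : B p p = 1) : Equiv.Perm (V × V × FreeGroup Bool) where
  toFun ω := (formReflection B p ω.1, formReflection B p ω.2.1,
    crossing B p ω.1 ω.2.1 * ω.2.2)
  invFun ω := (formReflection B p ω.1, formReflection B p ω.2.1,
    (crossing B p (formReflection B p ω.1) (formReflection B p ω.2.1))⁻¹ * ω.2.2)
  left_inv ω := by simp [formReflection_involutive hp]
  right_inv ω := by simp [formReflection_involutive hp]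

theorem crossingPerm_apply {p : V} (hp : B p p = 1) (v w : V) (h : FreeGroup Bool) :
    crossingPerm hp (v, w, h)
      = (formReflection B p v, formReflection B p w, crossing B p v w * h) := rfl

theorem ne_neg_self {p : V} (hp : B p p = 1) : -p ≠ p := by
  intro h
  have := congrArg (B p) h
  rw [map_neg, hp] at this
  norm_num at this

theorem crossingPerm_sq_left {p w : V} (hp : B p p = 1) (hpw : B p w ≤ -1) (hw : w ≠ p)
    (hw' : w ≠ -p) (h : FreeGroup Bool) :
    crossingPerm hp (crossingPerm hp (p, w, h)) = (p, w, FreeGroup.of true * h) := by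
  have hr : formReflection B p w ≠ p := by
    rwa [Ne, formReflection_eq_iff hp, formReflection_self hp]
  rw [crossingPerm_apply, crossingPerm_apply, crossing_left hpw hw, formReflection_self hp,
    map_neg, formReflection_self hp, neg_neg, formReflection_involutive hp,
    crossing_eq_one (ne_neg_self hp) hr, one_mul]

theorem crossingPerm_sq_right {p v : V} (hp : B p p = 1) (hvp : B v p ≤ -1) (hv : v ≠ p)
    (hv' : v ≠ -p) (h : FreeGroup Bool) :
    crossingPerm hp (crossingPerm hp (v, p, h)) = (v, p, FreeGroup.of false * h) := by
  have hr : formReflection B p v ≠ p := by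
    rwa [Ne, formReflection_eq_iff hp, formReflection_self hp]
  rw [crossingPerm_apply, crossingPerm_apply, crossing_right hvp hv, formReflection_self hp,
    map_neg, formReflection_self hp, neg_neg, formReflection_involutive hp,
    crossing_eq_one hr (ne_neg_self hp), one_mul]

theorem crossingPerm_of_ne {p v w : V} (hp : B p p = 1) (hv : v ≠ p) (hw : w ≠ p)
    (h : FreeGroup Bool) :
    crossingPerm hp (v, w, h) = (formReflection B p v, formReflection B p w, h) := by
  rw [crossingPerm_apply, crossing_eq_one hv hw, one_mul]

variable (B) in
/-- The crossings recorded by an alternating product of `n` reflections in `p, q, p, …`. -/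
noncomputable def altCrossing : ℕ → V → V → V → V → FreeGroup Bool
  | 0, _, _, _, _ => 1
  | n + 1, p, q, v, w => crossing B p (altReflection B n q p v) (altReflection B n q p w) *
      altCrossing n q p v w

theorem lift_crossingPerm_altProd {X : Type*} {e : X → V} (he : ∀ x, B (e x) (e x) = 1) (n : ℕ)
    (x y : X) (v w : V) (h : FreeGroup Bool) :
    FreeGroup.lift (fun x => crossingPerm (he x)) (altProd n x y) (v, w, h)
      = (altReflection B n (e x) (e y) v, altReflection B n (e x) (e y) w,
        altCrossing B n (e x) (e y) v w * h) := by
  induction n generalizing x y with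
  | zero => simp [altProd, altReflection, altCrossing]
  | succ n ih =>
    simp only [altProd, map_mul, FreeGroup.lift_apply_of, Equiv.Perm.mul_apply, ih,
      crossingPerm_apply, altReflection, altCrossing, Module.End.mul_apply, mul_assoc]

open Classical in
/-- The number of dihedral roots among the first `n` whose opposite is `v`. -/
noncomputable def rootCount (θ : ℝ) (n : ℕ) (p q v : V) : ℕ :=
  ∑ j ∈ Finset.range n, if v = -dihedralRoot θ j p q then 1 else 0

theorem rootCount_eq_zero {θ : ℝ} {n : ℕ} {p q v : V} :
    rootCount θ n p q v = 0 ↔ ∀ j < n, v ≠ -dihedralRoot θ j p q := by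
  simp [rootCount]

open Classical in
theorem rootCount_succ {θ : ℝ} (hθ : sin θ ≠ 0) (n : ℕ) {p q : V} (hp : B p p = 1)
    (hqp : B q p = -cos θ) (v : V) :
    rootCount θ (n + 1) p q (formReflection B p v)
      = (if v = p then 1 else 0) + rootCount θ n q p v := by
  rw [rootCount, Finset.sum_range_succ', add_comm, rootCount]
  simp only [formReflection_eq_iff hp, dihedralRoot_zero hθ, dihedralRoot_succ _ _ hp hqp, map_neg,
    formReflection_involutive hp, formReflection_self hp, neg_neg]

theorem rootCount_comm (k : ℕ) (p q v : V) :
    rootCount (π / k) k p q v = rootCount (π / k) k q p v := by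
  rw [rootCount, ← Finset.sum_range_reflect]
  refine Finset.sum_congr rfl fun j hj => ?_
  rw [dihedralRoot_reverse (Finset.mem_range.mp hj)]

theorem altCrossing_eq_pow (hB : ∀ v w, B v w = B w v) {θ : ℝ} (hθ : sin θ ≠ 0) (n : ℕ) {p q : V}
    (hp : B p p = 1) (hq : B q q = 1) (hpq : B p q = -cos θ) {v w : V} (hvw : B v w ≤ -1)
    (h0 : rootCount θ n p q (altReflection B n p q v) = 0 ∨
      rootCount θ n p q (altReflection B n p q w) = 0) :
    altCrossing B n p q v w =
      FreeGroup.of true ^ rootCount θ n p q (altReflection B n p q v) *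
        FreeGroup.of false ^ rootCount θ n p q (altReflection B n p q w) := by
  induction n generalizing p q with
  | zero => simp [altCrossing, rootCount]
  | succ n ih =>
    have hqp : B q p = -cos θ := by rw [hB, hpq]
    simp only [altReflection, altCrossing, Module.End.mul_apply,
      rootCount_succ hθ n hp hqp] at h0 ⊢
    have hvw' : B (altReflection B n q p v) (altReflection B n q p w) ≤ -1 := by
      rwa [apply_altReflection hB n hq hp]
    rw [ih hq hp hqp (by omega), crossing, if_pos hvw']
    rcases h0 with h0 | h0 <;> obtain ⟨h1, h2⟩ := Nat.add_eq_zero_iff.mp h0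
    · rw [h1, h2]
      split_ifs at h1 ⊢ <;> simp [pow_add]
    · rw [h1, h2]
      split_ifs at h1 ⊢ <;> simp [pow_add]

theorem altCrossing_of_neg_one_lt (hB : ∀ v w, B v w = B w v) (n : ℕ) {p q : V} (hp : B p p = 1)
    (hq : B q q = 1) {v w : V} (hvw : -1 < B v w) : altCrossing B n p q v w = 1 := by
  induction n generalizing p q with
  | zero => rfl
  | succ n ih =>
    rw [altCrossing, ih hq hp, crossing, apply_altReflection hB n hq hp, if_neg (not_le.mpr hvw),
      one_mul]

theorem altCrossing_comm (hB : ∀ v w, B v w = B w v) {k : ℕ} (hk : 2 ≤ k) {p q : V}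
    (hp : B p p = 1) (hq : B q q = 1) (hpq : B p q = -cos (π / k)) (v w : V) :
    altCrossing B k p q v w = altCrossing B k q p v w := by
  have hqp : B q p = -cos (π / k) := by rw [hB, hpq]
  have hs := (sin_pi_div_pos hk).ne'
  rcases lt_or_ge (-1) (B v w) with hvw | hvw
  · rw [altCrossing_of_neg_one_lt hB k hp hq hvw, altCrossing_of_neg_one_lt hB k hq hp hvw]
  · have h0 : rootCount (π / k) k p q (altReflection B k p q v) = 0 ∨
        rootCount (π / k) k p q (altReflection B k p q w) = 0 := by
      simp only [rootCount_eq_zero]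
      by_contra! h
      obtain ⟨⟨i, hi, hv⟩, j, hj, hw⟩ := h
      have := neg_one_lt_apply_dihedralRoot hk hi hj hp hq hpq hqp
      have h' := apply_altReflection hB k hp hq v w
      rw [hv, hw] at h'
      simp only [map_neg, LinearMap.neg_apply, neg_neg] at h'
      linarith
    have hcomm := altReflection_comm hk hp hq hpq hqp
    rw [altCrossing_eq_pow hB hs k hp hq hpq hvw h0, altCrossing_eq_pow hB hs k hq hp hqp hvw]
    · rw [← hcomm, rootCount_comm k q p, rootCount_comm k q p]
    · rwa [← hcomm, rootCount_comm k q p, rootCount_comm k q p]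

end Crossing

/-! ### Monoid word length -/

/-- An action for which positive generators do not increase `P`, negative ones do not increase
`N`, and `P`, `N` differ by at most one, bounds the monoid length from below. -/
theorem le_length_of_mem_monoid {G Ω : Type*} [Group G] [MulAction G Ω] (S : Set G)
    (P N : Ω → ℕ) (hP : ∀ s ∈ S, ∀ ω, P (s • ω) ≤ P ω) (hN : ∀ s ∈ S, ∀ ω, N (s⁻¹ • ω) ≤ N ω)
    (hPN : ∀ ω, P ω ≤ N ω + 1) (hNP : ∀ ω, N ω ≤ P ω + 1) (l : List G)
    (hl : ∀ g ∈ l, g ∈ Submonoid.closure S ∨ g⁻¹ ∈ Submonoid.closure S)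
    (ω : Ω) (hPω : P ω = 0) (hNω : N ω = 0) :
    P (l.prod • ω) ≤ l.length ∧ N (l.prod • ω) ≤ l.length := by
  have key : ∀ g ∈ Submonoid.closure S,
      (∀ ω, P (g • ω) ≤ P ω) ∧ ∀ ω, N (g⁻¹ • ω) ≤ N ω := by
    intro g hg
    induction hg using Submonoid.closure_induction with
    | mem s hs => exact ⟨hP s hs, hN s hs⟩
    | one => simp
    | mul g h _ _ ihg ihh =>
      refine ⟨fun ω => ?_, fun ω => ?_⟩
      · rw [mul_smul]; exact (ihg.1 _).trans (ihh.1 _)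
      · rw [mul_inv_rev, mul_smul]; exact (ihh.2 _).trans (ihg.2 _)
  induction l with
  | nil => simp [hPω, hNω]
  | cons g l ih =>
    obtain ⟨ihP, ihN⟩ := ih fun h hh => hl h (List.mem_cons_of_mem _ hh)
    rw [List.prod_cons, mul_smul, List.length_cons]
    have h₁ := hPN (g • l.prod • ω)
    have h₂ := hNP (g • l.prod • ω)
    rcases hl g List.mem_cons_self with hg | hg
    · have := (key g hg).1 (l.prod • ω)
      omega
    · have := (key _ hg).2 (l.prod • ω)
      rw [inv_inv] at this
      omega

/-! ### The geometric representation -/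

section Geometric

open Real

variable {X : Type*} [Fintype X] (m : X → X → ℕ∞)

open Classical in
/-- The canonical bilinear form of the Coxeter group with labels `m`. -/
noncomputable def coxeterForm : (X → ℝ) →ₗ[ℝ] (X → ℝ) →ₗ[ℝ] ℝ :=
  Matrix.toLinearMap₂' ℝ
    (Matrix.of fun x y => if x = y then (1 : ℝ) else -cos (π / (m x y).toNat))

open Classical in
/-- The simple roots. -/
noncomputable def simpleRoot (x : X) : X → ℝ := Pi.single x 1

variable {m}

open Classical in
theorem coxeterForm_simpleRoot (x y : X) : coxeterForm m (simpleRoot x) (simpleRoot y)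
    = if x = y then 1 else -cos (π / (m x y).toNat) := by
  simp only [coxeterForm, simpleRoot, Matrix.toLinearMap₂'_apply, Matrix.of_apply]
  rw [Finset.sum_eq_single x (fun i _ hi => by simp [Pi.single_eq_of_ne hi]) (by simp),
    Finset.sum_eq_single y (fun j _ hj => by simp [Pi.single_eq_of_ne hj]) (by simp)]
  simp only [Pi.single_eq_same, one_smul]

theorem coxeterForm_self (x : X) : coxeterForm m (simpleRoot x) (simpleRoot x) = 1 := by
  rw [coxeterForm_simpleRoot, if_pos rfl]

theorem coxeterForm_of_ne {x y : X} (h : x ≠ y) :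
    coxeterForm m (simpleRoot x) (simpleRoot y) = -cos (π / (m x y).toNat) := by
  rw [coxeterForm_simpleRoot, if_neg h]

theorem coxeterForm_symm (hsymm : ∀ x y, m x y = m y x) (v w : X → ℝ) :
    coxeterForm m v w = coxeterForm m w v := by
  simp only [coxeterForm, Matrix.toLinearMap₂'_apply, Matrix.of_apply]
  rw [Finset.sum_comm]
  refine Finset.sum_congr rfl fun x _ => Finset.sum_congr rfl fun y _ => ?_
  rw [hsymm x y]
  by_cases h : x = y
  · subst h; simp only [smul_eq_mul]; ring
  · simp only [if_neg h, if_neg (Ne.symm h), smul_eq_mul]; ring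

theorem coxeterForm_le_neg_half {x y : X} (h : x ≠ y) (hfin : m x y ≠ ⊤) (h3 : 3 ≤ m x y) :
    coxeterForm m (simpleRoot x) (simpleRoot y) ≤ -(1 / 2) := by
  rw [coxeterForm_of_ne h]
  lift m x y to ℕ using hfin with k
  have hk : (3 : ℝ) ≤ k := by
    have : 3 ≤ k := by exact_mod_cast h3
    exact_mod_cast this
  rw [ENat.toNat_natCast, neg_le_neg_iff, ← cos_pi_div_three]
  refine cos_le_cos_of_nonneg_of_le_pi (by positivity) (by linarith [pi_pos]) ?_
  exact div_le_div_of_nonneg_left pi_pos.le (by norm_num) hk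

/-- The action of the Artin group recording the crossings of two disjoint walls. -/
noncomputable def artinCrossing (hsymm : ∀ x y : X, m x y = m y x)
    (hge2 : ∀ x y : X, x ≠ y → 2 ≤ m x y) :
    ArtinGroup m →* Equiv.Perm ((X → ℝ) × (X → ℝ) × FreeGroup Bool) :=
  PresentedGroup.toGroup (f := fun x => crossingPerm (coxeterForm_self (m := m) x)) <| by
    rintro _ ⟨x, y, k, hxy, hk, rfl⟩
    have hB := coxeterForm_symm hsymm
    have hk2 : 2 ≤ k := by
      have := hge2 x y hxy
      rw [hk] at this
      exact_mod_cast this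
    have hform : coxeterForm m (simpleRoot x) (simpleRoot y) = -cos (π / k) := by
      rw [coxeterForm_of_ne hxy, hk, ENat.toNat_natCast]
    rw [map_mul, map_inv, mul_inv_eq_one]
    ext1 ⟨v, w, h⟩
    rw [lift_crossingPerm_altProd, lift_crossingPerm_altProd,
      altReflection_comm hk2 (coxeterForm_self x) (coxeterForm_self y) hform (by rw [hB, hform]),
      altCrossing_comm hB hk2 (coxeterForm_self x) (coxeterForm_self y) hform]

theorem artinCrossing_artinGen (hsymm : ∀ x y : X, m x y = m y x)
    (hge2 : ∀ x y : X, x ≠ y → 2 ≤ m x y) (x : X) :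
    artinCrossing hsymm hge2 (artinGen m x) = crossingPerm (coxeterForm_self (m := m) x) :=
  PresentedGroup.toGroup.of _

/-- For a triangle with labels at least `3`, the walls of `a` and `b c b` are disjoint, and `a a`
and `b c c b⁻¹` are loops around them. -/
theorem exists_artinCrossing_loops (hsymm : ∀ x y : X, m x y = m y x)
    (hge2 : ∀ x y : X, x ≠ y → 2 ≤ m x y) {a b c : X} (hab : a ≠ b) (hbc : b ≠ c) (hac : a ≠ c)
    (hab_fin : m a b ≠ ⊤) (hbc_fin : m b c ≠ ⊤) (hac_fin : m a c ≠ ⊤)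
    (hab3 : 3 ≤ m a b) (hbc3 : 3 ≤ m b c) (hac3 : 3 ≤ m a c) :
    ∃ v w : X → ℝ, ∀ h : FreeGroup Bool,
      artinCrossing hsymm hge2 (artinGen m a * artinGen m a) (v, w, h)
        = (v, w, FreeGroup.of true * h) ∧
      artinCrossing hsymm hge2
        (artinGen m b * artinGen m c * artinGen m c * (artinGen m b)⁻¹) (v, w, h)
        = (v, w, FreeGroup.of false * h) := by
  have hB := coxeterForm_symm hsymm
  have hself := coxeterForm_self (m := m)
  have hle_ab := coxeterForm_le_neg_half hab hab_fin hab3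
  have hle_bc := coxeterForm_le_neg_half hbc hbc_fin hbc3
  have hle_ac := coxeterForm_le_neg_half hac hac_fin hac3
  set v := simpleRoot a with hv
  set w := formReflection (coxeterForm m) (simpleRoot b) (simpleRoot c) with hw
  set v' := formReflection (coxeterForm m) (simpleRoot b) v with hv'
  have hvw : coxeterForm m v w ≤ -1 := by
    rw [hw, formReflection_apply, map_sub, map_smul, smul_eq_mul, hB (simpleRoot c)]
    nlinarith
  have hwb : formReflection (coxeterForm m) (simpleRoot b) w = simpleRoot c :=
    formReflection_involutive (hself b) _
  have hv'c : coxeterForm m v' (simpleRoot c) ≤ -1 := by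
    rw [← hwb, hv', apply_formReflection hB (hself b)]
    exact hvw
  have hvc : v c = 0 := by simp [hv, simpleRoot, hac.symm]
  have hwc : w c = 1 := by
    simp [hw, formReflection_apply, simpleRoot, hbc.symm]
  have hv'a : v' a = 1 := by
    simp [hv', hv, formReflection_apply, simpleRoot, hab]
  have hba : (simpleRoot b : X → ℝ) a = 0 := by simp [simpleRoot, hab]
  have hca : (simpleRoot c : X → ℝ) a = 0 := by simp [simpleRoot, hac]
  have hcb : (simpleRoot c : X → ℝ) ≠ simpleRoot b := fun h => by
    simpa [simpleRoot, hbc.symm] using congrFun h c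
  have hv'b : v' ≠ simpleRoot b := fun h => by
    have := congrFun h a
    rw [hv'a, hba] at this
    exact one_ne_zero this
  refine ⟨v, w, fun h => ⟨?_, ?_⟩⟩
  · rw [map_mul, artinCrossing_artinGen, Equiv.Perm.mul_apply]
    refine crossingPerm_sq_left (hself a) hvw (fun h => ?_) (fun h => ?_) _
    all_goals
      have := congrFun h c
      simp [hwc, ← hv, hvc] at this
  · have hloop (h : FreeGroup Bool) :
        crossingPerm (hself b) (v', simpleRoot c, h) = (v, w, h) := by
      rw [crossingPerm_of_ne (hself b) hv'b hcb, hv', formReflection_involutive (hself b)]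
    simp only [map_mul, map_inv, artinCrossing_artinGen, Equiv.Perm.mul_apply]
    rw [Equiv.Perm.inv_eq_iff_eq.mpr (hloop h).symm, crossingPerm_sq_right (hself c) hv'c, hloop]
    all_goals
      intro h
      have := congrFun h a
      simp [hv'a, hca] at this

end Geometric

/-- If `Γ` contains a triangle all of whose labels are finite and at least `3`,
then the monoid Cayley graph of `A_Γ` has infinite diameter. -/
theorem artin_infinite_diameter_of_large_triangle {X : Type*} [Fintype X] (m : X → X → ℕ∞)
    (hsymm : ∀ x y : X, m x y = m y x) (hge2 : ∀ x y : X, x ≠ y → 2 ≤ m x y)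
    (a b c : X) (hab : a ≠ b) (hbc : b ≠ c) (hac : a ≠ c)
    (hab_fin : m a b ≠ ⊤) (hbc_fin : m b c ≠ ⊤) (hac_fin : m a c ≠ ⊤)
    (hab3 : 3 ≤ m a b) (hbc3 : 3 ≤ m b c) (hac3 : 3 ≤ m a c) :
    ∀ n : ℕ, ∃ g : ArtinGroup m, n < monoidDist (artinMonoid m) 1 g := by
  intro n
  obtain ⟨v, w, hloop⟩ := exists_artinCrossing_loops hsymm hge2 hab hbc hac hab_fin hbc_fin hac_fin
    hab3 hbc3 hac3
  set α := artinGen m a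
  set β := artinGen m b
  set γ := artinGen m c
  have hact (k : ℕ) : artinCrossing hsymm hge2 ((α * α * (β * γ * γ * β⁻¹)⁻¹) ^ k) (v, w, 1)
      = (v, w, (FreeGroup.of true * (FreeGroup.of false)⁻¹) ^ k) := by
    induction k with
    | zero => simp
    | succ k ih =>
      rw [pow_succ', map_mul, Equiv.Perm.mul_apply, ih, map_mul, Equiv.Perm.mul_apply, map_inv]
      have hinv (h : FreeGroup Bool) :
          (artinCrossing hsymm hge2 (β * γ * γ * β⁻¹))⁻¹ (v, w, h)
            = (v, w, (FreeGroup.of false)⁻¹ * h) := by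
        rw [Equiv.Perm.inv_eq_iff_eq, (hloop _).2, mul_inv_cancel_left]
      rw [hinv, (hloop _).1, pow_succ', mul_assoc]
  have hgen (x : X) : artinGen m x ∈ artinMonoid m := Submonoid.subset_closure ⟨x, rfl⟩
  refine ⟨(α * α * (β * γ * γ * β⁻¹)⁻¹) ^ (n + 1), ?_⟩
  set D := { k : ℕ | ∃ l : List (ArtinGroup m), l.length = k ∧
    (∀ a ∈ l, a ∈ artinMonoid m ∨ a⁻¹ ∈ artinMonoid m) ∧
    1⁻¹ * (α * α * (β * γ * γ * β⁻¹)⁻¹) ^ (n + 1) = l.prod }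
  have hne : D.Nonempty := by
    refine ⟨_, (List.replicate (n + 1) [α * α * β, (β * γ * γ)⁻¹]).flatten, rfl, ?_, ?_⟩
    · intro g hg
      simp only [List.mem_flatten, List.mem_replicate] at hg
      obtain ⟨_, ⟨-, rfl⟩, hg⟩ := hg
      rcases List.mem_pair.mp hg with rfl | rfl
      · exact Or.inl (mul_mem (mul_mem (hgen a) (hgen a)) (hgen b))
      · rw [inv_inv]
        exact Or.inr (mul_mem (mul_mem (hgen b) (hgen c)) (hgen c))
    · simp [List.prod_flatten, mul_assoc]
  obtain ⟨l, hlen, hl, hprod⟩ := Nat.sInf_mem hne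
  change n < sInf D
  rw [← hlen]
  let _ : MulAction (ArtinGroup m) ((X → ℝ) × (X → ℝ) × FreeGroup Bool) :=
    MulAction.compHom _ (artinCrossing hsymm hge2)
  have hsmul (g : ArtinGroup m) (ω : (X → ℝ) × (X → ℝ) × FreeGroup Bool) :
      g • ω = artinCrossing hsymm hge2 g ω := rfl
  have hbound := (le_length_of_mem_monoid (Set.range (artinGen m))
    (fun ω : (X → ℝ) × (X → ℝ) × FreeGroup Bool => signChanges true ω.2.2.toWord)
    (fun ω => signChanges false ω.2.2.toWord)
    (by
      rintro _ ⟨x, rfl⟩ ω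
      rw [hsmul, artinCrossing_artinGen]
      exact signChanges_crossing_mul_le _ _ _ _)
    (by
      rintro _ ⟨x, rfl⟩ ω
      rw [hsmul, map_inv, artinCrossing_artinGen]
      exact signChanges_crossing_inv_mul_le _ _ _ _)
    (fun _ => signChanges_le_add_one _ _ _) (fun _ => signChanges_le_add_one _ _ _)
    l hl (v, w, 1) (by simp [signChanges]) (by simp [signChanges])).2
  rw [← hprod, inv_one, one_mul, hsmul, hact, signChanges_toWord_pow] at hbound
  omega
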